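/- Plurisubharmonic case of finite type for Hartogs domains: if ρ is plurisubharmonic near a point z¹ and h is strictly plurisubharmonic near w¹ with ρ(z¹)+h(w¹)=0, and Φ=(φ,ψ) : 𝔻 → ℂ^n×ℂ^m is holomorphic with Φ(0)=(z¹,w¹) and all derivatives of r∘Φ of order ≤ 2k vanish at 0 where r(z,w)=ρ(z)+h(w), then ψ^{(j)}(0) = 0 for all 1 ≤ j ≤ k. -/

import Mathlib

/-- Wirtinger derivative ∂f/∂z_j. -/
noncomputable def wd {d : ℕ} (j : Fin d) (f : (Fin d → ℂ) → ℂ) (z : Fin d → ℂ) : ℂ :=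
  (fderiv ℝ f z (Pi.single j 1) - Complex.I * fderiv ℝ f z (Pi.single j Complex.I)) / 2

/-- Wirtinger derivative ∂f/∂z̄_j. -/
noncomputable def wdbar {d : ℕ} (j : Fin d) (f : (Fin d → ℂ) → ℂ) (z : Fin d → ℂ) : ℂ :=
  (fderiv ℝ f z (Pi.single j 1) + Complex.I * fderiv ℝ f z (Pi.single j Complex.I)) / 2

/-- The complex Hessian (Levi) form ∑_{j,k} ∂²f/∂z_j∂z̄_k t_j t̄_k (real part). -/
noncomputable def hessForm {d : ℕ} (f : (Fin d → ℂ) → ℂ) (z t : Fin d → ℂ) : ℝ :=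
  (∑ j, ∑ k, wd j (fun w => wdbar k f w) z * t j * (starRingEnd ℂ) (t k)).re

/-- The pairing ⟨∂f(z), t⟩ = ∑_j ∂f/∂z_j(z) t_j. -/
noncomputable def dpair {d : ℕ} (f : (Fin d → ℂ) → ℂ) (z t : Fin d → ℂ) : ℂ :=
  ∑ j, wd j f z * t j


open Filter Topology Asymptotics

/-- The Levi form of `f` at `z`, up to the factor `1/4`, expressed through the real second
derivative; on `ℂ` and at `t = 1` it is the Laplacian. -/
noncomputable def leviSum {E F : Type*} [NormedAddCommGroup E] [NormedSpace ℂ E]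
    [NormedAddCommGroup F] [NormedSpace ℝ F] (f : E → F) (z t : E) : F :=
  fderiv ℝ (fderiv ℝ f) z t t +
    fderiv ℝ (fderiv ℝ f) z (Complex.I • t) (Complex.I • t)

theorem leviSum_add {E F : Type*} [NormedAddCommGroup E] [NormedSpace ℂ E]
    [NormedAddCommGroup F] [NormedSpace ℝ F] {f g : E → F} {z : E}
    (hf : ContDiffAt ℝ 2 f z) (hg : ContDiffAt ℝ 2 g z) (t : E) :
    leviSum (fun x => f x + g x) z t = leviSum f z t + leviSum g z t := by
  have hev : fderiv ℝ (fun x => f x + g x) =ᶠ[𝓝 z] fun x => fderiv ℝ f x + fderiv ℝ g x := by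
    filter_upwards [hf.eventually (by simp), hg.eventually (by simp)] with x hx hy
    exact fderiv_fun_add (hx.differentiableAt (by simp)) (hy.differentiableAt (by simp))
  have hf' := (hf.fderiv_right (m := 1) (by norm_num)).differentiableAt (by simp)
  have hg' := (hg.fderiv_right (m := 1) (by norm_num)).differentiableAt (by simp)
  simp only [leviSum, hev.fderiv_eq, fderiv_fun_add hf' hg', add_apply]
  abel

/-- The Levi form of `f` controls the Laplacian of `f` along holomorphic curves. -/
theorem leviSum_comp_curve {E F : Type*} [NormedAddCommGroup E] [NormedSpace ℂ E]
    [CompleteSpace E] [NormedAddCommGroup F] [NormedSpace ℝ F] {f : E → F} {γ : ℂ → E} {ζ : ℂ}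
    (hf : ContDiffAt ℝ 2 f (γ ζ)) (hγ : AnalyticAt ℂ γ ζ) :
    leviSum (f ∘ γ) ζ 1 = leviSum f (γ ζ) (deriv γ ζ) := by
  have hev : fderiv ℝ (f ∘ γ) =ᶠ[𝓝 ζ] fun ξ => (fderiv ℝ f (γ ξ)).comp
      ((ContinuousLinearMap.toSpanSingleton ℂ (deriv γ ξ)).restrictScalars ℝ) := by
    filter_upwards [hγ.continuousAt.eventually (hf.eventually (by simp)),
      hγ.eventually_analyticAt] with ξ h1 h2
    exact ((h1.differentiableAt (by simp)).hasFDerivAt.comp ξ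
      (h2.differentiableAt.hasDerivAt.hasFDerivAt.restrictScalars ℝ)).fderiv
  have hγ' := hγ.differentiableAt.hasDerivAt.hasFDerivAt.restrictScalars ℝ
  have hγ'' := hγ.deriv.differentiableAt.hasDerivAt.hasFDerivAt.restrictScalars ℝ
  have hf' := ((hf.fderiv_right (m := 1) (by norm_num)).differentiableAt (by simp)).hasFDerivAt
  have key : ∀ v : ℂ, fderiv ℝ (fderiv ℝ (f ∘ γ)) ζ v v =
      fderiv ℝ (fderiv ℝ f) (γ ζ) (v • deriv γ ζ) (v • deriv γ ζ) +
        fderiv ℝ f (γ ζ) ((v * v) • deriv (deriv γ) ζ) := by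
    intro v
    have hd : DifferentiableAt ℝ (fderiv ℝ (f ∘ γ)) ζ :=
      ((hf.comp ζ ((hγ.contDiffAt (n := 2)).restrict_scalars ℝ)).fderiv_right (m := 1)
        (by norm_num)).differentiableAt (by simp)
    have h1 : HasFDerivAt (fun ξ => fderiv ℝ (f ∘ γ) ξ v) _ ζ :=
      hd.hasFDerivAt.clm_apply (hasFDerivAt_const v ζ)
    have h2 : HasFDerivAt (fun ξ => fderiv ℝ f (γ ξ) (v • deriv γ ξ)) _ ζ :=
      (hf'.comp ζ hγ').clm_apply (hγ''.const_smul v)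
    have h3 := (h2.congr_of_eventuallyEq (hev.mono fun ξ hξ => by simp [hξ])).unique h1
    have h4 := DFunLike.congr_fun h3 v
    simp [smul_smul] at h4
    rw [← h4, add_comm]
  rw [leviSum, leviSum]
  simp only [smul_eq_mul, mul_one]
  rw [key 1, key Complex.I]
  simp only [one_smul, mul_one, Complex.I_mul_I, neg_smul, map_neg]
  abel

theorem im_fderiv_eq_zero {E : Type*} [NormedAddCommGroup E] [NormedSpace ℝ E] {g : E → ℂ}
    (hg : ∀ z, (g z).im = 0) (z u : E) : (fderiv ℝ g z u).im = 0 := by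
  by_cases hd : DifferentiableAt ℝ g z
  · have h1 := (Complex.imCLM.hasFDerivAt.comp z hd.hasFDerivAt)
    have h2 : (Complex.imCLM ∘ g : E → ℝ) = fun _ => 0 := by ext x; simp [hg]
    rw [h2] at h1
    have := DFunLike.congr_fun (h1.unique (hasFDerivAt_const (0 : ℝ) z)) u
    simpa using this
  · simp [fderiv_zero_of_not_differentiableAt hd]

theorem wd_wdbar_eq {d : ℕ} {f : (Fin d → ℂ) → ℂ} {z : Fin d → ℂ}
    (hf : DifferentiableAt ℝ (fderiv ℝ f) z) (j k : Fin d) :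
    wd j (fun w => wdbar k f w) z =
      (fderiv ℝ (fderiv ℝ f) z (Pi.single j 1) (Pi.single k 1) +
        fderiv ℝ (fderiv ℝ f) z (Pi.single j Complex.I) (Pi.single k Complex.I) +
        Complex.I * (fderiv ℝ (fderiv ℝ f) z (Pi.single j 1) (Pi.single k Complex.I) -
          fderiv ℝ (fderiv ℝ f) z (Pi.single j Complex.I) (Pi.single k 1))) / 4 := by
  have happ : ∀ v, HasFDerivAt (fun w => fderiv ℝ f w v)
      ((fderiv ℝ (fderiv ℝ f) z).flip v) z := fun v => by
    simpa using hf.hasFDerivAt.clm_apply (hasFDerivAt_const v z)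
  have h1 := (((happ (Pi.single k 1)).add
    ((happ (Pi.single k Complex.I)).const_mul Complex.I)).const_mul (2⁻¹ : ℂ))
  have h2 : (fun w => wdbar k f w) = fun w => (2⁻¹ : ℂ) * (fderiv ℝ f w (Pi.single k 1) +
      Complex.I * fderiv ℝ f w (Pi.single k Complex.I)) := by
    ext w; rw [wdbar]; ring
  rw [wd, h2]
  erw [h1.fderiv]
  simp
  linear_combination (-(1 / 4 : ℂ)) * fderiv ℝ (fderiv ℝ f) z (Pi.single j Complex.I)
    (Pi.single k Complex.I) * Complex.I_mul_I

theorem eq_sum_re_smul_single_add_im_smul_single {d : ℕ} (t : Fin d → ℂ) :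
    t = ∑ j, ((t j).re • (Pi.single j 1 : Fin d → ℂ) +
      (t j).im • (Pi.single j Complex.I : Fin d → ℂ)) := by
  ext i
  simp only [Finset.sum_apply, Pi.add_apply, Pi.smul_apply, Pi.single_apply, smul_ite, smul_zero,
    Finset.sum_add_distrib, Finset.sum_ite_eq, Finset.mem_univ, if_true, Complex.real_smul,
    mul_one, Complex.re_add_im]

theorem four_mul_hessForm {d : ℕ} {f : (Fin d → ℂ) → ℂ} {z : Fin d → ℂ}
    (hreal : ∀ z, (f z).im = 0) (hf : DifferentiableAt ℝ (fderiv ℝ f) z) (t : Fin d → ℂ) :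
    4 * hessForm f z t = (leviSum f z t).re := by
  set B := fderiv ℝ (fderiv ℝ f) z with hB
  have him : ∀ u v, (B u v).im = 0 := by
    intro u v
    have h1 : HasFDerivAt (fun w => fderiv ℝ f w v) (B.flip v) z := by
      simpa using hf.hasFDerivAt.clm_apply (hasFDerivAt_const v z)
    have h2 := im_fderiv_eq_zero (g := fun w => fderiv ℝ f w v)
      (fun w => im_fderiv_eq_zero hreal w v) z u
    rw [h1.fderiv] at h2
    simpa using h2
  have hIt : Complex.I • t =
      ∑ j, ((-(t j).im) • (Pi.single j 1 : Fin d → ℂ) +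
        (t j).re • (Pi.single j Complex.I : Fin d → ℂ)) := by
    rw [eq_sum_re_smul_single_add_im_smul_single (Complex.I • t)]
    simp
  have hexp : ∀ a b : Fin d → ℝ,
      (B (∑ j, (a j • (Pi.single j 1 : Fin d → ℂ) + b j • (Pi.single j Complex.I : Fin d → ℂ)))
        (∑ j, (a j • (Pi.single j 1 : Fin d → ℂ) +
          b j • (Pi.single j Complex.I : Fin d → ℂ)))).re =
      ∑ j, ∑ k, (a j * a k * (B (Pi.single j 1) (Pi.single k 1)).re +
        a j * b k * (B (Pi.single j 1) (Pi.single k Complex.I)).re +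
        b j * a k * (B (Pi.single j Complex.I) (Pi.single k 1)).re +
        b j * b k * (B (Pi.single j Complex.I) (Pi.single k Complex.I)).re) := by
    intro a b
    simp only [map_sum, sum_apply, Complex.re_sum]
    rw [Finset.sum_comm]
    refine Finset.sum_congr rfl fun j _ => Finset.sum_congr rfl fun k _ => ?_
    simp
    ring
  rw [leviSum, ← hB, Complex.add_re, hIt, hexp]
  conv_rhs => enter [1]; rw [eq_sum_re_smul_single_add_im_smul_single t, hexp]
  rw [hessForm, Complex.re_sum, Finset.mul_sum, ← Finset.sum_add_distrib]
  refine Finset.sum_congr rfl fun j _ => ?_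
  rw [Complex.re_sum, Finset.mul_sum, ← Finset.sum_add_distrib]
  refine Finset.sum_congr rfl fun k _ => ?_
  rw [wd_wdbar_eq hf, ← hB]
  have h4 : (4 : ℂ) = ((4 : ℝ) : ℂ) := by norm_num
  rw [h4]
  simp [him]
  ring

/-- Taylor's formula with Peano remainder for a function whose derivatives up to order `N`
vanish. -/
theorem isLittleO_of_iteratedFDeriv_eq_zero.{u} {E : Type u} [NormedAddCommGroup E]
    [NormedSpace ℝ E] (N : ℕ) {F : Type u} [NormedAddCommGroup F] [NormedSpace ℝ F] {G : E → F}
    (hG : ContDiffAt ℝ (⊤ : ℕ∞) G 0) (h0 : ∀ j ≤ N, iteratedFDeriv ℝ j G 0 = 0) :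
    G =o[𝓝 0] fun x => ‖x‖ ^ N := by
  induction N generalizing F with
  | zero =>
    have hz : G 0 = 0 := by
      have := DFunLike.congr_fun (h0 0 le_rfl) 0
      simpa using this
    simp only [pow_zero, isLittleO_one_iff]
    simpa [hz] using hG.continuousAt.tendsto
  | succ N ih =>
    have hz : G 0 = 0 := by
      have := DFunLike.congr_fun (h0 0 (Nat.zero_le _)) 0
      simpa using this
    have hder : fderiv ℝ G =o[𝓝 0] fun x => ‖x‖ ^ N := by
      refine ih (hG.fderiv_right (m := (⊤ : ℕ∞)) (by simp)) fun j hj => ?_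
      rw [← norm_eq_zero, norm_iteratedFDeriv_fderiv, h0 _ (by omega), norm_zero]
    refine isLittleO_iff.2 fun c hc => ?_
    have hdiff : ∀ᶠ x in 𝓝 (0 : E), DifferentiableAt ℝ G x :=
      ((hG.of_le (m := 1) (by simp)).eventually (by simp)).mono
        fun x hx => hx.differentiableAt (by simp)
    obtain ⟨ε, hε, hball⟩ := Metric.eventually_nhds_iff.1 (hdiff.and (isLittleO_iff.1 hder hc))
    refine Metric.eventually_nhds_iff.2 ⟨ε, hε, fun x hx => ?_⟩
    have hx' : ‖x‖ < ε := by simpa using hx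
    have hle := (convex_closedBall (0 : E) ‖x‖).norm_image_sub_le_of_norm_fderiv_le
      (f := G) (𝕜 := ℝ) (C := c * ‖x‖ ^ N) (x := 0) (y := x)
      (fun y hy => (hball (by simp at hy ⊢; linarith)).1)
      (fun y hy => by
        have hy' : ‖y‖ ≤ ‖x‖ := by simpa using hy
        refine (hball (by simp; linarith)).2.trans ?_
        simp only [norm_pow, norm_norm]
        gcongr)
      (by simp) (by simp)
    simpa [hz, pow_succ, mul_assoc] using hle

theorem AnalyticAt.iteratedDeriv_eq_zero_of_isLittleO {E : Type*} [NormedAddCommGroup E]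
    [NormedSpace ℂ E] [CompleteSpace E] {f : ℂ → E} {N : ℕ} (hf : AnalyticAt ℂ f 0)
    (ho : f =o[𝓝 0] fun z => ‖z‖ ^ N) {j : ℕ} (hj : j ≤ N) : iteratedDeriv j f 0 = 0 := by
  suffices h : ((N + 1 : ℕ) : ℕ∞) ≤ analyticOrderAt f 0 from
    (natCast_le_analyticOrderAt_iff_iteratedDeriv_eq_zero hf).1 h j (by omega)
  by_contra! hlt
  have hne : analyticOrderAt f 0 ≠ ⊤ := ne_top_of_lt hlt
  obtain ⟨n, hn⟩ := ENat.ne_top_iff_exists.1 hne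
  rw [← hn, Nat.cast_lt] at hlt
  obtain ⟨g, hg, hg0, hfg⟩ := hf.analyticOrderAt_eq_natCast.1 hn.symm
  have h1 : f =o[𝓝 0] fun z : ℂ => z ^ n := by
    refine ho.trans_isBigO ?_
    have : (fun z : ℂ => z ^ N) =O[𝓝 0] fun z : ℂ => z ^ n := by
      refine IsBigO.of_bound 1 ?_
      filter_upwards [Metric.closedBall_mem_nhds (0 : ℂ) one_pos] with z hz
      rw [norm_pow, norm_pow, one_mul]
      exact pow_le_pow_of_le_one (norm_nonneg z) (by simpa using hz) (by omega)
    simpa using this.norm_left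
  have h2 : Tendsto g (𝓝[≠] 0) (𝓝 0) := by
    rw [← isLittleO_one_iff ℂ]
    have h3 := (isBigO_refl (fun z : ℂ => (z ^ n)⁻¹) (𝓝[≠] 0)).smul_isLittleO
      (h1.mono nhdsWithin_le_nhds)
    refine h3.congr' ?_ ?_
    · filter_upwards [self_mem_nhdsWithin, hfg.filter_mono nhdsWithin_le_nhds] with z hz h
      have hz' : z ^ n ≠ 0 := pow_ne_zero _ hz
      simp [h, smul_smul, hz']
    · filter_upwards [self_mem_nhdsWithin] with z hz
      have hz' : z ^ n ≠ 0 := pow_ne_zero _ hz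
      simp [hz']
  exact hg0 (tendsto_nhds_unique (hg.continuousAt.tendsto.mono_left nhdsWithin_le_nhds) h2)

theorem eventually_norm_leviSum_sub_le {E F : Type*} [NormedAddCommGroup E] [NormedSpace ℂ E]
    [NormedAddCommGroup F] [NormedSpace ℝ F] {f : E → F} {w : E}
    (hf : ContinuousAt (fderiv ℝ (fderiv ℝ f)) w) {ε : ℝ} (hε : 0 < ε) :
    ∀ᶠ z in 𝓝 w, ∀ t, ‖leviSum f w t - leviSum f z t‖ ≤ ε * ‖t‖ ^ 2 := by
  filter_upwards [hf (Metric.ball_mem_nhds (fderiv ℝ (fderiv ℝ f) w) (half_pos hε))] with z hz t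
  replace hz : ‖fderiv ℝ (fderiv ℝ f) w - fderiv ℝ (fderiv ℝ f) z‖ < ε / 2 :=
    (dist_eq_norm (fderiv ℝ (fderiv ℝ f) w) (fderiv ℝ (fderiv ℝ f) z)).symm.trans_lt
      (Metric.mem_ball'.1 hz)
  set A := fderiv ℝ (fderiv ℝ f) w - fderiv ℝ (fderiv ℝ f) z with hA
  have hsub : leviSum f w t - leviSum f z t = A t t + A (Complex.I • t) (Complex.I • t) := by
    simp only [leviSum, hA, sub_apply]
    abel
  rw [hsub]
  calc _ ≤ ‖A t t‖ + ‖A (Complex.I • t) (Complex.I • t)‖ := norm_add_le _ _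
    _ ≤ ‖A‖ * ‖t‖ * ‖t‖ + ‖A‖ * ‖Complex.I • t‖ * ‖Complex.I • t‖ :=
      add_le_add (A.le_opNorm₂ _ _) (A.le_opNorm₂ _ _)
    _ = 2 * ‖A‖ * ‖t‖ ^ 2 := by simp only [norm_smul, Complex.norm_I]; ring
    _ ≤ 2 * (ε / 2) * ‖t‖ ^ 2 := by gcongr
    _ = ε * ‖t‖ ^ 2 := by ring

/-- Strict positivity of the Levi form at a point gives a uniform lower bound nearby. -/
theorem exists_eventually_leviSum_ge {E : Type*} [NormedAddCommGroup E] [NormedSpace ℂ E]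
    [ProperSpace E] {f : E → ℂ} {w : E} (hf : ContinuousAt (fderiv ℝ (fderiv ℝ f)) w)
    (hpos : ∀ t, t ≠ 0 → 0 < (leviSum f w t).re) :
    ∃ c > 0, ∀ᶠ z in 𝓝 w, ∀ t, c * ‖t‖ ^ 2 ≤ (leviSum f z t).re := by
  obtain ⟨c, hc, hmin⟩ := (isCompact_sphere (0 : E) 1).exists_forall_le'
    (f := fun t => (leviSum f w t).re) (a := 0)
    (by unfold leviSum; fun_prop) (fun t ht => hpos t (by rintro rfl; simp at ht))
  refine ⟨c / 2, by positivity, ?_⟩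
  filter_upwards [eventually_norm_leviSum_sub_le hf (half_pos hc)] with z hz t
  have hscale : c * ‖t‖ ^ 2 ≤ (leviSum f w t).re := by
    rcases eq_or_ne t 0 with rfl | ht
    · simp [leviSum]
    have hn : ‖t‖ ≠ 0 := norm_ne_zero_iff.2 ht
    have h1 := hmin ((‖t‖⁻¹ : ℝ) • t) (by simp [norm_smul, hn])
    have h2 : leviSum f w ((‖t‖⁻¹ : ℝ) • t) = (‖t‖⁻¹ : ℝ) • (‖t‖⁻¹ : ℝ) • leviSum f w t := by
      simp only [leviSum, smul_comm Complex.I (‖t‖⁻¹ : ℝ) t, map_smul,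
        smul_apply, smul_add]
    simp only [h2, Complex.smul_re, smul_eq_mul] at h1
    calc c * ‖t‖ ^ 2 ≤ (‖t‖⁻¹ * (‖t‖⁻¹ * (leviSum f w t).re)) * ‖t‖ ^ 2 := by gcongr
      _ = (leviSum f w t).re := by field_simp
  have hbound := (Complex.re_le_norm _).trans (hz t)
  rw [Complex.sub_re] at hbound
  linarith

/-- if ρ is plurisubharmonic near z¹, h is strictly plurisubharmonic
near w¹, ρ(z¹)+h(w¹) = 0, Φ = (φ,ψ) is holomorphic on the disc with Φ(0) = (z¹,w¹),
and all derivatives of r∘Φ of order ≤ 2k vanish at 0 (r = ρ + h), then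
ψ^{(j)}(0) = 0 for 1 ≤ j ≤ k. -/
theorem stmt10 (n m k : ℕ)
    (U : Set (Fin n → ℂ)) (hU : IsOpen U)
    (V : Set (Fin m → ℂ)) (hV : IsOpen V)
    (ρ : (Fin n → ℂ) → ℂ) (h : (Fin m → ℂ) → ℂ)
    (hρsm : ContDiffOn ℝ (⊤ : ℕ∞) ρ U) (hhsm : ContDiffOn ℝ (⊤ : ℕ∞) h V)
    (hρreal : ∀ z, (ρ z).im = 0) (hhreal : ∀ w, (h w).im = 0)
    (z₁ : Fin n → ℂ) (w₁ : Fin m → ℂ) (hz₁ : z₁ ∈ U) (hw₁ : w₁ ∈ V)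
    (hbd : ρ z₁ + h w₁ = 0)
    (hρpsh : ∀ z ∈ U, ∀ t : Fin n → ℂ, 0 ≤ hessForm ρ z t)
    (hhspsh : ∀ w ∈ V, ∀ t : Fin m → ℂ, t ≠ 0 → 0 < hessForm h w t)
    (φ : ℂ → (Fin n → ℂ)) (ψ : ℂ → (Fin m → ℂ))
    (hφ : DifferentiableOn ℂ φ (Metric.ball 0 1))
    (hψ : DifferentiableOn ℂ ψ (Metric.ball 0 1))
    (hφmaps : Set.MapsTo φ (Metric.ball 0 1) U)
    (hψmaps : Set.MapsTo ψ (Metric.ball 0 1) V)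
    (hφ0 : φ 0 = z₁) (hψ0 : ψ 0 = w₁)
    (hvan : ∀ j : ℕ, j ≤ 2 * k →
      iteratedFDeriv ℝ j (fun ζ => ρ (φ ζ) + h (ψ ζ)) 0 = 0) :
    ∀ j : ℕ, 1 ≤ j → j ≤ k → iteratedDeriv j ψ 0 = 0 := by
  intro j hj1 hjk
  obtain ⟨k, rfl⟩ : ∃ K, k = K + 1 := ⟨k - 1, by omega⟩
  have hφan : ∀ ζ ∈ Metric.ball (0 : ℂ) 1, AnalyticAt ℂ φ ζ := fun ζ hζ =>
    hφ.analyticAt (Metric.isOpen_ball.mem_nhds hζ)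
  have hψan : ∀ ζ ∈ Metric.ball (0 : ℂ) 1, AnalyticAt ℂ ψ ζ := fun ζ hζ =>
    hψ.analyticAt (Metric.isOpen_ball.mem_nhds hζ)
  have hρat : ∀ z ∈ U, ContDiffAt ℝ (⊤ : ℕ∞) ρ z := fun z hz => hρsm.contDiffAt (hU.mem_nhds hz)
  have hhat : ∀ w ∈ V, ContDiffAt ℝ (⊤ : ℕ∞) h w := fun w hw => hhsm.contDiffAt (hV.mem_nhds hw)
  have h2le : (2 : WithTop ℕ∞) ≤ ((⊤ : ℕ∞) : WithTop ℕ∞) :=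
    WithTop.coe_le_coe.2 le_top
  have hρd : ∀ z ∈ U, DifferentiableAt ℝ (fderiv ℝ ρ) z := fun z hz =>
    (((hρat z hz).of_le h2le).fderiv_right (m := 1) (by norm_num)).differentiableAt (by simp)
  have hhd : ∀ w ∈ V, DifferentiableAt ℝ (fderiv ℝ h) w := fun w hw =>
    (((hhat w hw).of_le h2le).fderiv_right (m := 1) (by norm_num)).differentiableAt (by simp)
  have hρφ : ∀ ζ ∈ Metric.ball (0 : ℂ) 1, ContDiffAt ℝ (⊤ : ℕ∞) (ρ ∘ φ) ζ := fun ζ hζ =>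
    (hρat _ (hφmaps hζ)).comp ζ ((hφan ζ hζ).contDiffAt.restrict_scalars ℝ)
  have hhψ : ∀ ζ ∈ Metric.ball (0 : ℂ) 1, ContDiffAt ℝ (⊤ : ℕ∞) (h ∘ ψ) ζ := fun ζ hζ =>
    (hhat _ (hψmaps hζ)).comp ζ ((hψan ζ hζ).contDiffAt.restrict_scalars ℝ)
  have h0 : (0 : ℂ) ∈ Metric.ball (0 : ℂ) 1 := by simp
  set F : ℂ → ℂ := fun ζ => ρ (φ ζ) + h (ψ ζ) with hF
  have hFsm : ContDiffAt ℝ (⊤ : ℕ∞) F 0 := (hρφ 0 h0).add (hhψ 0 h0)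
  have hD2 : fderiv ℝ (fderiv ℝ F) =o[𝓝 0] fun ζ => ‖ζ‖ ^ (2 * k) := by
    refine isLittleO_of_iteratedFDeriv_eq_zero _
      ((hFsm.fderiv_right (m := (⊤ : ℕ∞)) (by simp)).fderiv_right (by simp)) fun i hi => ?_
    rw [← norm_eq_zero, norm_iteratedFDeriv_fderiv, norm_iteratedFDeriv_fderiv,
      hvan _ (by omega), norm_zero]
  have hlap : ∀ ζ ∈ Metric.ball (0 : ℂ) 1,
      leviSum F ζ 1 = leviSum ρ (φ ζ) (deriv φ ζ) + leviSum h (ψ ζ) (deriv ψ ζ) := by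
    intro ζ hζ
    rw [← leviSum_comp_curve ((hρat _ (hφmaps hζ)).of_le h2le) (hφan ζ hζ),
      ← leviSum_comp_curve ((hhat _ (hψmaps hζ)).of_le h2le) (hψan ζ hζ)]
    exact leviSum_add ((hρφ ζ hζ).of_le h2le) ((hhψ ζ hζ).of_le h2le) 1
  obtain ⟨c, hc, hlow⟩ := exists_eventually_leviSum_ge (f := h) (w := ψ 0)
    ((((hhat _ (hψmaps h0)).fderiv_right (m := (⊤ : ℕ∞)) (by simp)).fderiv_right
      (m := (⊤ : ℕ∞)) (by simp)).continuousAt)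
    (fun t ht => by
      rw [← four_mul_hessForm hhreal (hhd _ (hψmaps h0))]
      have := hhspsh _ (hψmaps h0) t ht
      positivity)
  have hψ' : deriv ψ =o[𝓝 0] fun ζ => ‖ζ‖ ^ k := by
    refine isLittleO_iff.2 fun ε hε => ?_
    filter_upwards [Metric.isOpen_ball.mem_nhds h0, (hψan 0 h0).continuousAt.eventually hlow,
      isLittleO_iff.1 hD2 (c := c * ε ^ 2 / 2) (by positivity)] with ζ hζ hge hle
    have hnonneg : 0 ≤ (leviSum ρ (φ ζ) (deriv φ ζ)).re := by
      rw [← four_mul_hessForm hρreal (hρd _ (hφmaps hζ))]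
      have := hρpsh _ (hφmaps hζ) (deriv φ ζ)
      positivity
    have hup : (leviSum F ζ 1).re ≤ 2 * ‖fderiv ℝ (fderiv ℝ F) ζ‖ := by
      refine (Complex.re_le_norm _).trans ((norm_add_le _ _).trans ?_)
      have h1 := (fderiv ℝ (fderiv ℝ F) ζ).le_opNorm₂ 1 1
      have h2 := (fderiv ℝ (fderiv ℝ F) ζ).le_opNorm₂ (Complex.I • 1) (Complex.I • 1)
      simp only [smul_eq_mul, mul_one, norm_one, Complex.norm_I] at h1 h2 ⊢
      linarith
    rw [hlap ζ hζ, Complex.add_re] at hup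
    have hge' := hge (deriv ψ ζ)
    simp only [norm_pow, norm_norm] at hle ⊢
    have hsq : c * ‖deriv ψ ζ‖ ^ 2 ≤ c * (ε * ‖ζ‖ ^ k) ^ 2 := by
      calc c * ‖deriv ψ ζ‖ ^ 2 ≤ 2 * (c * ε ^ 2 / 2 * ‖ζ‖ ^ (2 * k)) := by linarith
        _ = c * (ε * ‖ζ‖ ^ k) ^ 2 := by ring
    exact le_of_sq_le_sq (le_of_mul_le_mul_left hsq hc) (by positivity)
  obtain ⟨i, rfl⟩ : ∃ i, j = i + 1 := ⟨j - 1, by omega⟩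
  rw [iteratedDeriv_succ']
  exact (hψan 0 h0).deriv.iteratedDeriv_eq_zero_of_isLittleO hψ' (by omega)
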